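/- Let u₀ be a probability density on ℝⁿ with finite second moment, and for t > 0 let u(·,t) = u₀ * M_{2t} be the solution of the heat equation with initial datum u₀. Then for every t > 0, d/dt √(E(u(·,t))) ≤ √(I(u(·,t))), with equality for all t when u₀ is a centered Gaussian density. -/

import Mathlib

open MeasureTheory Real
open scoped RealInnerProductSpace

noncomputable section

/-- `ℝⁿ` as a Euclidean (inner product) space. -/
abbrev Euc (n : ℕ) := EuclideanSpace ℝ (Fin n)

/-- `f` is a probability density on `ℝⁿ`. -/
def IsProbDensity {n : ℕ} (f : Euc n → ℝ) : Prop :=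
  Measurable f ∧ (∀ x, 0 ≤ f x) ∧ (∫ x, f x) = 1

/-- Shannon entropy `H(f) = -∫ f log f`. -/
def shannonEntropy {n : ℕ} (f : Euc n → ℝ) : ℝ := -∫ x, f x * Real.log (f x)

/-- Shannon entropy power `N(f) = exp((2/n) H(f))`. -/
def entropyPower (n : ℕ) (f : Euc n → ℝ) : ℝ :=
  Real.exp ((2 / (n : ℝ)) * shannonEntropy f)

/-- Fisher information `I(f) = ∫_{f>0} |∇f|²/f`. -/
def fisherInfo {n : ℕ} (f : Euc n → ℝ) : ℝ :=
  ∫ x in {x | 0 < f x}, ‖gradient f x‖ ^ 2 / f x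

/-- Second moment `E(f) = ∫ |x|² f(x) dx`. -/
def secondMoment {n : ℕ} (f : Euc n → ℝ) : ℝ := ∫ x, ‖x‖ ^ 2 * f x

/-- The centered isotropic Gaussian density `M_σ` on `ℝⁿ`. -/
def gaussianDensity (n : ℕ) (σ : ℝ) : Euc n → ℝ :=
  fun x => (2 * π * σ) ^ (-(n : ℝ) / 2) * Real.exp (-‖x‖ ^ 2 / (2 * σ))

/-- `f` is a (translated isotropic) Gaussian density. -/
def IsGaussianDensity {n : ℕ} (f : Euc n → ℝ) : Prop :=
  ∃ (m : Euc n) (σ : ℝ), 0 < σ ∧ ∀ x, f x = gaussianDensity n σ (x - m)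

/-- The solution of the heat equation with initial datum `u₀`: the convolution
`u(·,t) = u₀ * M_{2t}`. -/
def heatSol {n : ℕ} (u₀ : Euc n → ℝ) (t : ℝ) : Euc n → ℝ :=
  fun x => ∫ y, u₀ y * gaussianDensity n (2 * t) (x - y)

theorem norm_sq_mul_exp_neg_mul_norm_sq_le {V : Type*} [NormedAddCommGroup V]
    {b : ℝ} (hb : 0 < b) (v : V) :
    ‖v‖ ^ 2 * exp (-b * ‖v‖ ^ 2) ≤ 2 / b * exp (-(b / 2) * ‖v‖ ^ 2) := by
  have h1 : b / 2 * ‖v‖ ^ 2 ≤ exp (b / 2 * ‖v‖ ^ 2) := by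
    linarith [add_one_le_exp (b / 2 * ‖v‖ ^ 2)]
  have h2 : ‖v‖ ^ 2 ≤ 2 / b * exp (b / 2 * ‖v‖ ^ 2) := by
    calc ‖v‖ ^ 2 = 2 / b * (b / 2 * ‖v‖ ^ 2) := by field_simp
      _ ≤ _ := by gcongr
  calc _ ≤ (2 / b * exp (b / 2 * ‖v‖ ^ 2)) * exp (-b * ‖v‖ ^ 2) := by gcongr
    _ = _ := by rw [mul_assoc, ← exp_add]; ring_nf

section GaussianMoments

variable {V : Type*} [NormedAddCommGroup V] [InnerProductSpace ℝ V]

theorem hasGradientAt_const_mul_exp_neg_norm_sq [CompleteSpace V] (K s : ℝ) (x : V) :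
    HasGradientAt (fun x : V => K * exp (-‖x‖ ^ 2 / (2 * s)))
      ((-(1 / s) * (K * exp (-‖x‖ ^ 2 / (2 * s)))) • x) x := by
  rw [hasGradientAt_iff_hasFDerivAt]
  have h := ((((hasFDerivAt_id x).norm_sq.neg).mul_const (1 / (2 * s))).exp).const_mul K
  simp only [id, mul_one_div] at h
  refine h.congr_fderiv ?_
  ext v
  simp
  ring

variable [FiniteDimensional ℝ V] [MeasurableSpace V] [BorelSpace V]

theorem integrable_exp_neg_mul_norm_sq {b : ℝ} (hb : 0 < b) :
    Integrable (fun v : V => exp (-b * ‖v‖ ^ 2)) := by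
  by_contra h
  have h1 := GaussianFourier.integral_rexp_neg_mul_sq_norm (V := V) hb
  rw [integral_undef h] at h1
  have : 0 < (π / b) ^ ((Module.finrank ℝ V : ℝ) / 2) := by positivity
  linarith

theorem integrable_norm_sq_mul_exp_neg_mul_norm_sq {b : ℝ} (hb : 0 < b) :
    Integrable (fun v : V => ‖v‖ ^ 2 * exp (-b * ‖v‖ ^ 2)) := by
  refine ((integrable_exp_neg_mul_norm_sq (V := V) (half_pos hb)).const_mul (2 / b)).mono'
    (by fun_prop) (.of_forall fun v => ?_)
  rw [norm_of_nonneg (by positivity)]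
  exact norm_sq_mul_exp_neg_mul_norm_sq_le hb v

theorem integral_norm_sq_mul_exp_neg_mul_norm_sq {b : ℝ} (hb : 0 < b) :
    ∫ v : V, ‖v‖ ^ 2 * exp (-b * ‖v‖ ^ 2) =
      Module.finrank ℝ V / (2 * b) * (π / b) ^ ((Module.finrank ℝ V : ℝ) / 2) := by
  have h1 : HasDerivAt (fun a : ℝ => ∫ v : V, exp (-a * ‖v‖ ^ 2))
      (∫ v : V, -(‖v‖ ^ 2 * exp (-b * ‖v‖ ^ 2))) b := by
    refine (hasDerivAt_integral_of_dominated_loc_of_deriv_le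
      (bound := fun v : V => ‖v‖ ^ 2 * exp (-(b / 2) * ‖v‖ ^ 2))
      (F' := fun a v => -(‖v‖ ^ 2 * exp (-a * ‖v‖ ^ 2)))
      (Ioi_mem_nhds (half_lt_self hb)) (.of_forall fun a => by fun_prop)
      (integrable_exp_neg_mul_norm_sq hb) (by fun_prop) (.of_forall fun v a ha => ?_)
      (integrable_norm_sq_mul_exp_neg_mul_norm_sq (half_pos hb))
      (.of_forall fun v a _ => ?_)).2
    · rw [norm_neg, norm_of_nonneg (by positivity)]
      have : b / 2 ≤ a := le_of_lt ha
      gcongr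
    · have := (((hasDerivAt_id a).neg).mul_const (‖v‖ ^ 2)).exp
      simp only [id, Pi.neg_apply] at this
      exact this.congr_deriv (by ring)
  have h2 : HasDerivAt (fun a : ℝ => (π / a) ^ ((Module.finrank ℝ V : ℝ) / 2))
      (-(Module.finrank ℝ V / (2 * b) * (π / b) ^ ((Module.finrank ℝ V : ℝ) / 2))) b := by
    have h := ((hasDerivAt_inv hb.ne').const_mul π).rpow_const
      (p := (Module.finrank ℝ V : ℝ) / 2) (Or.inl (by positivity))
    simp only [← div_eq_mul_inv] at h
    refine h.congr_deriv ?_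
    rw [rpow_sub_one (by positivity)]
    field_simp
  have h3 := h1.unique (h2.congr_of_eventuallyEq ?_)
  · rw [integral_neg] at h3
    linarith
  · filter_upwards [Ioi_mem_nhds hb] with a ha
    exact GaussianFourier.integral_rexp_neg_mul_sq_norm ha

end GaussianMoments

section GaussianDensity

variable {n : ℕ} {σ : ℝ}

theorem gaussianDensity_eq_const_mul_exp (z : Euc n) :
    gaussianDensity n σ z =
      (2 * π * σ) ^ (-(n : ℝ) / 2) * exp (-(1 / (2 * σ)) * ‖z‖ ^ 2) := by
  rw [gaussianDensity]
  congr 2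
  ring

theorem gaussianDensity_pos (hσ : 0 < σ) (z : Euc n) : 0 < gaussianDensity n σ z := by
  unfold gaussianDensity
  positivity

@[fun_prop]
theorem continuous_gaussianDensity : Continuous (gaussianDensity n σ) := by
  unfold gaussianDensity
  fun_prop

theorem integrable_gaussianDensity (hσ : 0 < σ) : Integrable (gaussianDensity n σ) := by
  rw [funext gaussianDensity_eq_const_mul_exp]
  exact (integrable_exp_neg_mul_norm_sq (by positivity)).const_mul _

theorem gaussianDensity_const_mul_rpow (hσ : 0 < σ) :
    (2 * π * σ) ^ (-(n : ℝ) / 2) * (π / (1 / (2 * σ))) ^ ((n : ℝ) / 2) = 1 := by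
  rw [show π / (1 / (2 * σ)) = 2 * π * σ by field_simp, ← rpow_add (by positivity)]
  ring_nf
  simp

theorem integral_gaussianDensity (hσ : 0 < σ) : ∫ z, gaussianDensity n σ z = 1 := by
  rw [funext gaussianDensity_eq_const_mul_exp, integral_const_mul,
    GaussianFourier.integral_rexp_neg_mul_sq_norm (by positivity), finrank_euclideanSpace_fin,
    gaussianDensity_const_mul_rpow hσ]

theorem integrable_norm_sq_mul_gaussianDensity (hσ : 0 < σ) :
    Integrable (fun z : Euc n => ‖z‖ ^ 2 * gaussianDensity n σ z) := by
  simp_rw [gaussianDensity_eq_const_mul_exp, mul_left_comm]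
  exact (integrable_norm_sq_mul_exp_neg_mul_norm_sq (by positivity)).const_mul _

theorem secondMoment_gaussianDensity (hσ : 0 < σ) :
    secondMoment (gaussianDensity n σ) = n * σ := by
  simp_rw [secondMoment, gaussianDensity_eq_const_mul_exp, mul_left_comm]
  rw [integral_const_mul, integral_norm_sq_mul_exp_neg_mul_norm_sq (by positivity),
    finrank_euclideanSpace_fin, mul_left_comm, gaussianDensity_const_mul_rpow hσ]
  field_simp

theorem gaussianDensity_le (hσ : 0 < σ) (z : Euc n) :
    gaussianDensity n σ z ≤ (2 * π * σ) ^ (-(n : ℝ) / 2) := by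
  refine mul_le_of_le_one_right (by positivity) (exp_le_one_iff.2 ?_)
  rw [neg_div]
  exact neg_nonpos.2 (by positivity)

theorem exists_norm_sq_mul_gaussianDensity_le (hσ : 0 < σ) :
    ∃ C, ∀ z : Euc n, ‖z‖ ^ 2 * gaussianDensity n σ z ≤ C := by
  refine ⟨(2 * π * σ) ^ (-(n : ℝ) / 2) * (2 / (1 / (2 * σ))), fun z => ?_⟩
  rw [gaussianDensity_eq_const_mul_exp, mul_left_comm]
  gcongr
  refine (norm_sq_mul_exp_neg_mul_norm_sq_le (by positivity) z).trans ?_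
  refine mul_le_of_le_one_right (by positivity) (exp_le_one_iff.2 ?_)
  rw [neg_mul]
  exact neg_nonpos.2 (by positivity)

theorem norm_mul_gaussianDensity_le (hσ : 0 < σ) (z : Euc n) :
    ‖z‖ * gaussianDensity n σ z ≤ gaussianDensity n σ z + ‖z‖ ^ 2 * gaussianDensity n σ z := by
  have := gaussianDensity_pos hσ z
  nlinarith [sq_nonneg (‖z‖ - 1), sq_nonneg ‖z‖]

theorem integrable_gaussianDensity_smul (hσ : 0 < σ) :
    Integrable (fun z : Euc n => gaussianDensity n σ z • z) := by
  refine ((integrable_gaussianDensity hσ).add (integrable_norm_sq_mul_gaussianDensity hσ)).mono'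
    (by fun_prop) (.of_forall fun z => ?_)
  rw [norm_smul, norm_of_nonneg (gaussianDensity_pos hσ z).le, mul_comm]
  exact norm_mul_gaussianDensity_le hσ z

theorem integral_gaussianDensity_smul : ∫ z : Euc n, gaussianDensity n σ z • z = 0 := by
  have h := integral_neg_eq_self (fun z : Euc n => gaussianDensity n σ z • z) volume
  have h2 : (fun z : Euc n => gaussianDensity n σ (-z) • (-z)) =
      fun z => -(gaussianDensity n σ z • z) := by
    ext1 z
    simp [gaussianDensity]
  rw [h2, integral_neg] at h
  linear_combination (norm := module) (-(1 / 2 : ℝ)) • h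

end GaussianDensity

section HeatFlow

variable {n : ℕ} {u₀ : Euc n → ℝ} {t : ℝ}

theorem IsProbDensity.integrable (hu₀ : IsProbDensity u₀) : Integrable u₀ :=
  integrable_of_integral_eq_one hu₀.2.2

theorem integrable_mul_gaussianDensity_sub {f : Euc n → ℝ} (hf : Integrable f) (ht : 0 < t)
    (x : Euc n) : Integrable (fun y => f y * gaussianDensity n (2 * t) (x - y)) := by
  refine hf.mul_bdd (c := (2 * π * (2 * t)) ^ (-(n : ℝ) / 2)) (by fun_prop)
    (.of_forall fun y => ?_)
  rw [norm_of_nonneg (gaussianDensity_pos (by positivity) _).le]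
  exact gaussianDensity_le (by positivity) _

theorem integrable_mul_norm_sq_mul_gaussianDensity_sub {f : Euc n → ℝ} (hf : Integrable f)
    (ht : 0 < t) (x : Euc n) :
    Integrable (fun y => f y * (‖x - y‖ ^ 2 * gaussianDensity n (2 * t) (x - y))) := by
  obtain ⟨C, hC⟩ := exists_norm_sq_mul_gaussianDensity_le (n := n) (σ := 2 * t) (by positivity)
  refine hf.mul_bdd (c := C) (by fun_prop) (.of_forall fun y => ?_)
  have := gaussianDensity_pos (n := n) (σ := 2 * t) (by positivity) (x - y)
  rw [norm_of_nonneg (by positivity)]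
  exact hC _

/-- The convolution of `u₀` with `z ↦ M_{2t}(z) z`, which is `-2t` times the gradient of the
heat flow. -/
def heatFlux (u₀ : Euc n → ℝ) (t : ℝ) (x : Euc n) : Euc n :=
  ∫ y, u₀ y • (gaussianDensity n (2 * t) (x - y) • (x - y))

/-- The convolution of `u₀` with `z ↦ |z|² M_{2t}(z)`. -/
def heatSpread (u₀ : Euc n → ℝ) (t : ℝ) (x : Euc n) : ℝ :=
  ∫ y, u₀ y * (‖x - y‖ ^ 2 * gaussianDensity n (2 * t) (x - y))

theorem integrable_smul_gaussianDensity_smul_sub (hu₀ : IsProbDensity u₀) (ht : 0 < t)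
    (x : Euc n) :
    Integrable (fun y => u₀ y • (gaussianDensity n (2 * t) (x - y) • (x - y))) := by
  have := hu₀.1
  refine ((integrable_mul_gaussianDensity_sub hu₀.integrable ht x).add
    (integrable_mul_norm_sq_mul_gaussianDensity_sub hu₀.integrable ht x)).mono'
    (by fun_prop) (.of_forall fun y => ?_)
  rw [norm_smul, norm_smul, norm_of_nonneg (hu₀.2.1 y),
    norm_of_nonneg (gaussianDensity_pos (by positivity) _).le, Pi.add_apply, ← mul_add,
    mul_comm (gaussianDensity _ _ _)]
  exact mul_le_mul_of_nonneg_left (norm_mul_gaussianDensity_le (by positivity) _) (hu₀.2.1 y)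

theorem hasGradientAt_heatSol (hu₀ : IsProbDensity u₀) (ht : 0 < t) (x : Euc n) :
    HasGradientAt (heatSol u₀ t) ((-(1 / (2 * t))) • heatFlux u₀ t x) x := by
  have hm := hu₀.1
  obtain ⟨C, hC⟩ := exists_norm_sq_mul_gaussianDensity_le (n := n) (σ := 2 * t) (by positivity)
  rw [hasGradientAt_iff_hasFDerivAt, heatFlux, ← integral_smul]
  have hcomm := (InnerProductSpace.toDual ℝ (Euc n)).toContinuousLinearEquiv.integral_comp_comm
    (fun y => (-(1 / (2 * t))) • u₀ y • (gaussianDensity n (2 * t) (x - y) • (x - y)))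
    (μ := volume)
  refine HasFDerivAt.congr_fderiv ?_ hcomm
  refine hasFDerivAt_integral_of_dominated_of_fderiv_le (F' := fun x y =>
      InnerProductSpace.toDual ℝ (Euc n)
        ((-(1 / (2 * t))) • u₀ y • (gaussianDensity n (2 * t) (x - y) • (x - y))))
    (bound := fun y => (1 / (2 * t)) * (u₀ y * ((2 * π * (2 * t)) ^ (-(n : ℝ) / 2) + C)))
    Filter.univ_mem (.of_forall fun z => by fun_prop)
    (integrable_mul_gaussianDensity_sub hu₀.integrable ht x) ?_ (.of_forall fun y z _ => ?_)
    ((hu₀.integrable.mul_const _).const_mul _) (.of_forall fun y z _ => ?_)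
  · exact (InnerProductSpace.toDual ℝ (Euc n)).continuous.comp_aestronglyMeasurable
      (by fun_prop)
  · rw [LinearIsometryEquiv.norm_map, norm_smul, norm_smul, norm_smul, norm_neg,
      norm_of_nonneg (hu₀.2.1 y), norm_of_nonneg (by positivity : 0 ≤ 1 / (2 * t)),
      norm_of_nonneg (gaussianDensity_pos (by positivity) _).le,
      mul_comm (gaussianDensity _ _ _)]
    refine mul_le_mul_of_nonneg_left (mul_le_mul_of_nonneg_left ?_ (hu₀.2.1 y)) (by positivity)
    exact (norm_mul_gaussianDensity_le (by positivity) _).trans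
      (add_le_add (gaussianDensity_le (by positivity) _) (hC _))
  · have h := (hasGradientAt_const_mul_exp_neg_norm_sq
      ((2 * π * (2 * t)) ^ (-(n : ℝ) / 2)) (2 * t) (z - y)).hasFDerivAt
    have h2 := (h.comp z (hasFDerivAt_sub_const y)).const_mul (u₀ y)
    refine h2.congr_fderiv ?_
    ext v
    simp [gaussianDensity]
    ring

theorem heatSol_pos (hu₀ : IsProbDensity u₀) (ht : 0 < t) (x : Euc n) : 0 < heatSol u₀ t x := by
  have hG := fun y : Euc n => gaussianDensity_pos (n := n) (σ := 2 * t) (by positivity) (x - y)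
  have h1 : 0 < ∫ y, u₀ y := by rw [hu₀.2.2]; exact one_pos
  rw [integral_pos_iff_support_of_nonneg hu₀.2.1 hu₀.integrable] at h1
  rw [heatSol, integral_pos_iff_support_of_nonneg
    (fun y => mul_nonneg (hu₀.2.1 y) (hG y).le)
    (integrable_mul_gaussianDensity_sub hu₀.integrable ht x)]
  convert h1 using 2
  ext y
  simp [(hG y).ne']

theorem fisherInfo_heatSol (hu₀ : IsProbDensity u₀) (ht : 0 < t) :
    fisherInfo (heatSol u₀ t) = ∫ x, ‖gradient (heatSol u₀ t) x‖ ^ 2 / heatSol u₀ t x := by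
  simp [fisherInfo, heatSol_pos hu₀ ht]

theorem norm_heatFlux_sq_le (hu₀ : IsProbDensity u₀) (ht : 0 < t) (x : Euc n) :
    ‖heatFlux u₀ t x‖ ^ 2 ≤ heatSol u₀ t x * heatSpread u₀ t x := by
  set G : Euc n → ℝ := gaussianDensity n (2 * t)
  have hG : ∀ z, 0 < G z := gaussianDensity_pos (by positivity)
  set D := ∫ y, u₀ y * (‖x - y‖ * G (x - y))
  have hn : ∀ y, ‖u₀ y • (G (x - y) • (x - y))‖ = u₀ y * (‖x - y‖ * G (x - y)) := fun y => by
    rw [norm_smul, norm_smul, norm_of_nonneg (hu₀.2.1 y), norm_of_nonneg (hG _).le,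
      mul_comm (G _)]
  have i0 := integrable_mul_gaussianDensity_sub hu₀.integrable ht x
  have i1 : Integrable fun y => u₀ y * (‖x - y‖ * G (x - y)) :=
    (integrable_smul_gaussianDensity_smul_sub hu₀ ht x).norm.congr (.of_forall hn)
  have i2 := integrable_mul_norm_sq_mul_gaussianDensity_sub hu₀.integrable ht x
  have hD : ‖heatFlux u₀ t x‖ ≤ D :=
    (norm_integral_le_integral_norm _).trans_eq (integral_congr_ae (.of_forall hn))
  have hu := heatSol_pos hu₀ ht x
  have key : ∀ l : ℝ, 0 ≤ heatSpread u₀ t x - 2 * l * D + l ^ 2 * heatSol u₀ t x := fun l => by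
    have i21 : Integrable fun y => u₀ y * (‖x - y‖ ^ 2 * G (x - y)) -
        2 * l * (u₀ y * (‖x - y‖ * G (x - y))) := i2.sub (i1.const_mul _)
    rw [heatSpread, heatSol, ← integral_const_mul, ← integral_const_mul,
      ← integral_sub i2 (i1.const_mul _), ← integral_add i21 (i0.const_mul _)]
    refine integral_nonneg fun y => ?_
    have : 0 ≤ u₀ y * G (x - y) * (‖x - y‖ - l) ^ 2 :=
      mul_nonneg (mul_nonneg (hu₀.2.1 y) (hG _).le) (sq_nonneg _)
    refine this.trans_eq ?_
    ring
  have h := mul_nonneg hu.le (key (D / heatSol u₀ t x))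
  have h2 : heatSol u₀ t x * (heatSpread u₀ t x - 2 * (D / heatSol u₀ t x) * D +
      (D / heatSol u₀ t x) ^ 2 * heatSol u₀ t x) =
      heatSol u₀ t x * heatSpread u₀ t x - D ^ 2 := by
    field_simp
    ring
  have := pow_le_pow_left₀ (norm_nonneg _) hD 2
  linarith

theorem integrable_heatSpread (hu₀ : IsProbDensity u₀) (ht : 0 < t) :
    Integrable (heatSpread u₀ t) :=
  hu₀.integrable.integrable_convolution (ContinuousLinearMap.mul ℝ ℝ)
    (integrable_norm_sq_mul_gaussianDensity (σ := 2 * t) (by positivity))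

theorem integral_heatSpread (hu₀ : IsProbDensity u₀) (ht : 0 < t) :
    ∫ x, heatSpread u₀ t x = n * (2 * t) := by
  have h := integral_convolution (ContinuousLinearMap.mul ℝ ℝ) hu₀.integrable
    (integrable_norm_sq_mul_gaussianDensity (n := n) (σ := 2 * t) (by positivity))
  refine h.trans ?_
  rw [← secondMoment, secondMoment_gaussianDensity (by positivity), hu₀.2.2]
  simp

theorem integrable_smul_self (hu₀ : IsProbDensity u₀)
    (hE : Integrable (fun x => ‖x‖ ^ 2 * u₀ x)) : Integrable (fun x => u₀ x • x) := by
  have := hu₀.1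
  refine (hu₀.integrable.add hE).mono' (by fun_prop) (.of_forall fun x => ?_)
  rw [norm_smul, norm_of_nonneg (hu₀.2.1 x), Pi.add_apply]
  nlinarith [hu₀.2.1 x, sq_nonneg (‖x‖ - 1), sq_nonneg ‖x‖]

/-- The convolution of `y ↦ u₀(y) y` with `z ↦ M_{2t}(z) z` along the inner product. -/
def heatCross (u₀ : Euc n → ℝ) (t : ℝ) (x : Euc n) : ℝ :=
  ∫ y, inner ℝ (u₀ y • y) (gaussianDensity n (2 * t) (x - y) • (x - y))

theorem integrable_heatCross (hu₀ : IsProbDensity u₀)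
    (hE : Integrable (fun x => ‖x‖ ^ 2 * u₀ x)) (ht : 0 < t) : Integrable (heatCross u₀ t) :=
  (integrable_smul_self hu₀ hE).integrable_convolution (innerSL ℝ)
    (integrable_gaussianDensity_smul (σ := 2 * t) (by positivity))

theorem integral_heatCross (hu₀ : IsProbDensity u₀)
    (hE : Integrable (fun x => ‖x‖ ^ 2 * u₀ x)) (ht : 0 < t) : ∫ x, heatCross u₀ t x = 0 := by
  have h := integral_convolution (innerSL ℝ) (integrable_smul_self hu₀ hE)
    (integrable_gaussianDensity_smul (n := n) (σ := 2 * t) (by positivity))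
  refine h.trans ?_
  rw [integral_gaussianDensity_smul, map_zero]

theorem inner_heatFlux (hu₀ : IsProbDensity u₀) (ht : 0 < t) (x : Euc n) :
    inner ℝ x (heatFlux u₀ t x) = heatCross u₀ t x + heatSpread u₀ t x := by
  have i1 := integrable_smul_gaussianDensity_smul_sub hu₀ ht x
  have i2 := integrable_mul_norm_sq_mul_gaussianDensity_sub hu₀.integrable ht x
  rw [← sub_eq_iff_eq_add, heatFlux, heatSpread, heatCross, ← integral_inner i1,
    ← integral_sub (i1.const_inner x) i2]
  refine integral_congr_ae (.of_forall fun y => ?_)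
  simp only [inner_smul_left, inner_smul_right, ← real_inner_self_eq_norm_sq, inner_sub_left,
    inner_sub_right, real_inner_comm, conj_trivial]
  ring

theorem norm_sq_mul_heatSol (hu₀ : IsProbDensity u₀)
    (hE : Integrable (fun x => ‖x‖ ^ 2 * u₀ x)) (ht : 0 < t) (x : Euc n) :
    ‖x‖ ^ 2 * heatSol u₀ t x = heatSol (fun y => ‖y‖ ^ 2 * u₀ y) t x +
      2 * heatCross u₀ t x + heatSpread u₀ t x := by
  have i0 := integrable_mul_gaussianDensity_sub hu₀.integrable ht x
  have iE := integrable_mul_gaussianDensity_sub hE ht x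
  have i1 := (integrable_smul_gaussianDensity_smul_sub hu₀ ht x).const_inner (𝕜 := ℝ) x
  have h := inner_heatFlux hu₀ ht x
  have h2 : ‖x‖ ^ 2 * heatSol u₀ t x = heatSol (fun y => ‖y‖ ^ 2 * u₀ y) t x +
      2 * inner ℝ x (heatFlux u₀ t x) - heatSpread u₀ t x := by
    have i2 := integrable_mul_norm_sq_mul_gaussianDensity_sub hu₀.integrable ht x
    have iE1 : Integrable fun y => ‖y‖ ^ 2 * u₀ y * gaussianDensity n (2 * t) (x - y) +
        2 * inner ℝ x (u₀ y • (gaussianDensity n (2 * t) (x - y) • (x - y))) :=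
      iE.add (i1.const_mul 2)
    rw [heatSol, heatSol, heatFlux, heatSpread, ← integral_inner
      (integrable_smul_gaussianDensity_smul_sub hu₀ ht x), ← integral_const_mul,
      ← integral_const_mul, ← integral_add iE (i1.const_mul 2),
      ← integral_sub iE1 i2]
    refine integral_congr_ae (.of_forall fun y => ?_)
    simp only [inner_smul_right, ← real_inner_self_eq_norm_sq, inner_sub_left,
      inner_sub_right, real_inner_comm]
    ring
  linarith

theorem integrable_heatSol {f : Euc n → ℝ} (hf : Integrable f) (ht : 0 < t) :
    Integrable (heatSol f t) :=
  hf.integrable_convolution (ContinuousLinearMap.mul ℝ ℝ)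
    (integrable_gaussianDensity (σ := 2 * t) (by positivity))

theorem integral_heatSol {f : Euc n → ℝ} (hf : Integrable f) (ht : 0 < t) :
    ∫ x, heatSol f t x = ∫ x, f x := by
  have h := integral_convolution (ContinuousLinearMap.mul ℝ ℝ) hf
    (integrable_gaussianDensity (n := n) (σ := 2 * t) (by positivity))
  refine h.trans ?_
  rw [integral_gaussianDensity (by positivity)]
  simp

theorem integrable_norm_sq_mul_heatSol (hu₀ : IsProbDensity u₀)
    (hE : Integrable (fun x => ‖x‖ ^ 2 * u₀ x)) (ht : 0 < t) :
    Integrable (fun x => ‖x‖ ^ 2 * heatSol u₀ t x) := by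
  simp_rw [norm_sq_mul_heatSol hu₀ hE ht]
  exact ((integrable_heatSol hE ht).add ((integrable_heatCross hu₀ hE ht).const_mul 2)).add
    (integrable_heatSpread hu₀ ht)

theorem secondMoment_heatSol (hu₀ : IsProbDensity u₀)
    (hE : Integrable (fun x => ‖x‖ ^ 2 * u₀ x)) (ht : 0 < t) :
    secondMoment (heatSol u₀ t) = secondMoment u₀ + 2 * n * t := by
  have iA := integrable_heatSol hE ht
  have iB := (integrable_heatCross hu₀ hE ht).const_mul 2
  have iAB : Integrable fun x => heatSol (fun y => ‖y‖ ^ 2 * u₀ y) t x + 2 * heatCross u₀ t x :=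
    iA.add iB
  simp_rw [secondMoment, norm_sq_mul_heatSol hu₀ hE ht]
  rw [integral_add iAB (integrable_heatSpread hu₀ ht), integral_add iA iB,
    integral_heatSol hE ht, integral_const_mul, integral_heatCross hu₀ hE ht,
    integral_heatSpread hu₀ ht]
  ring

theorem integrable_inner_gradient_heatSol (hu₀ : IsProbDensity u₀)
    (hE : Integrable (fun x => ‖x‖ ^ 2 * u₀ x)) (ht : 0 < t) :
    Integrable (fun x => inner ℝ x (gradient (heatSol u₀ t) x)) := by
  simp_rw [fun x => (hasGradientAt_heatSol hu₀ ht x).gradient, inner_smul_right,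
    inner_heatFlux hu₀ ht]
  exact ((integrable_heatCross hu₀ hE ht).add (integrable_heatSpread hu₀ ht)).const_mul _

theorem integral_inner_gradient_heatSol (hu₀ : IsProbDensity u₀)
    (hE : Integrable (fun x => ‖x‖ ^ 2 * u₀ x)) (ht : 0 < t) :
    ∫ x, inner ℝ x (gradient (heatSol u₀ t) x) = -n := by
  simp_rw [fun x => (hasGradientAt_heatSol hu₀ ht x).gradient, inner_smul_right,
    inner_heatFlux hu₀ ht]
  rw [integral_const_mul, integral_add (integrable_heatCross hu₀ hE ht)
    (integrable_heatSpread hu₀ ht), integral_heatCross hu₀ hE ht, integral_heatSpread hu₀ ht]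
  field_simp
  ring

theorem integrable_heatFlux (hu₀ : IsProbDensity u₀) (ht : 0 < t) : Integrable (heatFlux u₀ t) :=
  hu₀.integrable.integrable_convolution (ContinuousLinearMap.lsmul ℝ ℝ : ℝ →L[ℝ] Euc n →L[ℝ] Euc n)
    (integrable_gaussianDensity_smul (σ := 2 * t) (by positivity))

theorem integrable_norm_gradient_heatSol_sq_div (hu₀ : IsProbDensity u₀) (ht : 0 < t) :
    Integrable (fun x => ‖gradient (heatSol u₀ t) x‖ ^ 2 / heatSol u₀ t x) := by
  have hm := (integrable_heatFlux hu₀ ht).aestronglyMeasurable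
  have hm' : AEMeasurable (heatSol u₀ t) :=
    (integrable_heatSol hu₀.integrable ht).aestronglyMeasurable.aemeasurable
  simp_rw [fun x => (hasGradientAt_heatSol hu₀ ht x).gradient]
  refine ((integrable_heatSpread hu₀ ht).const_mul ((1 / (2 * t)) ^ 2)).mono'
    (((hm.const_smul (-(1 / (2 * t)))).norm.aemeasurable.pow_const 2).div
      hm').aestronglyMeasurable
    (.of_forall fun x => ?_)
  have hu := heatSol_pos hu₀ ht x
  rw [norm_of_nonneg (by positivity), div_le_iff₀ hu, norm_smul, mul_pow, norm_neg,
    norm_of_nonneg (by positivity : 0 ≤ 1 / (2 * t)), mul_assoc, mul_comm (heatSpread u₀ t x)]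
  gcongr
  exact norm_heatFlux_sq_le hu₀ ht x

theorem sq_le_secondMoment_mul_fisherInfo_heatSol (hu₀ : IsProbDensity u₀)
    (hE : Integrable (fun x => ‖x‖ ^ 2 * u₀ x)) (ht : 0 < t) :
    (n : ℝ) ^ 2 ≤ secondMoment (heatSol u₀ t) * fisherInfo (heatSol u₀ t) := by
  have iI := integrable_norm_gradient_heatSol_sq_div hu₀ ht
  have iX := integrable_inner_gradient_heatSol hu₀ hE ht
  have iE := integrable_norm_sq_mul_heatSol hu₀ hE ht
  have key : ∀ l : ℝ, 0 ≤ secondMoment (heatSol u₀ t) * (l * l) + (-2 * n) * l +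
      fisherInfo (heatSol u₀ t) := fun l => by
    have h : 0 ≤ ∫ x, (‖gradient (heatSol u₀ t) x‖ ^ 2 / heatSol u₀ t x +
        2 * l * inner ℝ x (gradient (heatSol u₀ t) x) +
        l ^ 2 * (‖x‖ ^ 2 * heatSol u₀ t x)) := by
      refine integral_nonneg fun x => ?_
      have hu := heatSol_pos hu₀ ht x
      have h1 : 0 ≤ ‖gradient (heatSol u₀ t) x + (l * heatSol u₀ t x) • x‖ ^ 2 /
        heatSol u₀ t x := by positivity
      refine h1.trans_eq ?_
      rw [norm_add_sq_real, inner_smul_right, norm_smul, mul_pow, real_inner_comm,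
        norm_eq_abs, sq_abs]
      field_simp
    have iIX : Integrable fun x => ‖gradient (heatSol u₀ t) x‖ ^ 2 / heatSol u₀ t x +
        2 * l * inner ℝ x (gradient (heatSol u₀ t) x) := iI.add (iX.const_mul _)
    rw [integral_add iIX (iE.const_mul _),
      integral_add iI (iX.const_mul _), integral_const_mul, integral_const_mul,
      integral_inner_gradient_heatSol hu₀ hE ht, ← fisherInfo_heatSol hu₀ ht,
      ← secondMoment] at h
    linarith
  have := discrim_le_zero key
  rw [discrim] at this
  linarith

theorem deriv_sqrt_secondMoment_heatSol (hu₀ : IsProbDensity u₀)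
    (hE : Integrable (fun x => ‖x‖ ^ 2 * u₀ x)) (ht : 0 < t) :
    deriv (fun s => √(secondMoment (heatSol u₀ s))) t = n / √(secondMoment (heatSol u₀ t)) := by
  have hev : (fun s => √(secondMoment (heatSol u₀ s))) =ᶠ[nhds t]
      fun s => √(secondMoment u₀ + 2 * n * s) := by
    filter_upwards [Ioi_mem_nhds ht] with s hs
    rw [secondMoment_heatSol hu₀ hE hs]
  rw [hev.deriv_eq, secondMoment_heatSol hu₀ hE ht]
  rcases Nat.eq_zero_or_pos n with rfl | hn
  · simp
  have h0 : 0 ≤ secondMoment u₀ :=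
    integral_nonneg fun x => mul_nonneg (by positivity) (hu₀.2.1 x)
  have h1 : 0 < secondMoment u₀ + 2 * n * t := by positivity
  have h := (((hasDerivAt_id t).const_mul (2 * n : ℝ)).const_add (secondMoment u₀)).sqrt h1.ne'
  simp only [id] at h
  rw [h.deriv]
  field_simp

theorem exists_heatSol_gaussianDensity_eq {σ : ℝ} (hσ : 0 < σ) (ht : 0 < t) :
    ∃ K, heatSol (gaussianDensity n σ) t =
      fun x => K * exp (-‖x‖ ^ 2 / (2 * (σ + 2 * t))) := by
  set s := σ + 2 * t with hs
  have hs0 : 0 < s := by positivity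
  set c := (2 * π * σ) ^ (-(n : ℝ) / 2) * (2 * π * (2 * t)) ^ (-(n : ℝ) / 2)
  refine ⟨c * ∫ y : Euc n, exp (-(s / (2 * σ * (2 * t))) * ‖y‖ ^ 2), ?_⟩
  ext x
  rw [← integral_sub_right_eq_self (fun y : Euc n => exp (-(s / (2 * σ * (2 * t))) * ‖y‖ ^ 2))
    ((σ / s) • x), heatSol, mul_right_comm, ← integral_const_mul]
  congr 1
  ext1 y
  rw [gaussianDensity, gaussianDensity, mul_mul_mul_comm, ← exp_add, mul_assoc c, ← exp_add]
  congr 2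
  rw [norm_sub_sq_real, norm_sub_sq_real, norm_smul, inner_smul_right, mul_pow, norm_eq_abs,
    sq_abs, real_inner_comm y x]
  field_simp
  rw [hs]
  ring

theorem fisherInfo_heatSol_gaussianDensity {σ : ℝ} (hσ : 0 < σ)
    (hu₀ : IsProbDensity (gaussianDensity n σ)) (ht : 0 < t) :
    fisherInfo (heatSol (gaussianDensity n σ) t) =
      secondMoment (heatSol (gaussianDensity n σ) t) / (σ + 2 * t) ^ 2 := by
  have hpos := heatSol_pos hu₀ ht
  rw [fisherInfo_heatSol hu₀ ht, secondMoment, ← integral_div]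
  obtain ⟨K, hK⟩ := exists_heatSol_gaussianDensity_eq (n := n) hσ ht
  have hgrad : ∀ x, gradient (heatSol (gaussianDensity n σ) t) x =
      (-(1 / (σ + 2 * t)) * heatSol (gaussianDensity n σ) t x) • x := fun x => by
    rw [hK]
    exact (hasGradientAt_const_mul_exp_neg_norm_sq K (σ + 2 * t) x).gradient
  congr 1
  ext1 x
  have := hpos x
  rw [hgrad, norm_smul, mul_pow, norm_eq_abs, sq_abs]
  field_simp

end HeatFlow

/-- If `u₀` is a probability density on `ℝⁿ` with finite second moment and
`u(·,t) = u₀ * M_{2t}` solves the heat equation, then for every `t > 0`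
`d/dt √(E(u(·,t))) ≤ √(I(u(·,t)))`, with equality for all `t` when `u₀` is a
centered Gaussian density. -/
theorem heat_sqrt_secondMoment_deriv_le
    {n : ℕ} (u₀ : Euc n → ℝ) (hu₀ : IsProbDensity u₀)
    (hE : Integrable (fun x => ‖x‖ ^ 2 * u₀ x)) :
    (∀ t : ℝ, 0 < t →
      deriv (fun s => Real.sqrt (secondMoment (heatSol u₀ s))) t ≤
        Real.sqrt (fisherInfo (heatSol u₀ t))) ∧
    ((∃ σ : ℝ, 0 < σ ∧ u₀ = gaussianDensity n σ) →
      ∀ t : ℝ, 0 < t →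
        deriv (fun s => Real.sqrt (secondMoment (heatSol u₀ s))) t =
          Real.sqrt (fisherInfo (heatSol u₀ t))) := by
  refine ⟨fun t ht => ?_, ?_⟩
  · rw [deriv_sqrt_secondMoment_heatSol hu₀ hE ht]
    refine div_le_of_le_mul₀ (sqrt_nonneg _) (sqrt_nonneg _) ?_
    have hI : 0 ≤ fisherInfo (heatSol u₀ t) :=
      integral_nonneg fun x => div_nonneg (sq_nonneg _) (heatSol_pos hu₀ ht x).le
    rw [mul_comm, ← sqrt_mul' _ hI]
    exact le_sqrt_of_sq_le (sq_le_secondMoment_mul_fisherInfo_heatSol hu₀ hE ht)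
  · rintro ⟨σ, hσ, rfl⟩ t ht
    have hs : 0 < σ + 2 * t := by positivity
    have hM : secondMoment (heatSol (gaussianDensity n σ) t) = n * (σ + 2 * t) := by
      rw [secondMoment_heatSol hu₀ hE ht, secondMoment_gaussianDensity hσ]
      ring
    rw [deriv_sqrt_secondMoment_heatSol hu₀ hE ht, fisherInfo_heatSol_gaussianDensity hσ hu₀ ht,
      sqrt_div' _ (sq_nonneg _), sqrt_sq hs.le]
    rw [show (n : ℝ) = secondMoment (heatSol (gaussianDensity n σ) t) / (σ + 2 * t) by
      rw [hM]; field_simp, div_right_comm, div_sqrt]
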